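/- arXiv:2103.13695 — 5 statements merged into one kernel-verified Lean document; each statement's English description precedes it below -/
import Mathlib

section
/- Let n ≥ 1 and i ∈ {1,…,n}. Then the operator σ_i on the Hochschild cochain space C^n(k_αG,M) is an involution: σ_i(σ_i(φ)) = φ for every φ ∈ C^n(k_αG,M). -/
/- Common setup: twisted group algebras modelled on their canonical basis.
An element of the twisted group algebra `k_αG` is modelled as a function `G → k`
(its coordinates in the basis `{ḡ : g ∈ G}`), and a Hochschild `n`-cochain
`Hom_k((k_αG)^{⊗n}, M)` is modelled by its values on basis tensors, i.e. as a
function `(Fin n → G) → M`.  Similarly a group cochain `C^n(H, A)` is a function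
`(Fin n → H) → A`; the one-dimensional module `k x̄` is modelled as `k` with the
action of `h` given by multiplication by the character `χ(h) = α(h,x)·α(x,h)⁻¹`. -/

namespace TwistedSym

section Defs

variable {k : Type*} [CommRing k] {G : Type*} [Group G] [DecidableEq G]
variable {M : Type*} [AddCommGroup M] [Module k M]
variable {H : Type*} [Group H]
variable {A : Type*} [AddCommGroup A] [DistribMulAction H A]

/-- The 2-cocycle condition `α(x,yz)α(y,z) = α(xy,z)α(x,y)`. -/
def IsCocycle (α : G → G → kˣ) : Prop :=
  ∀ x y z : G, α x (y * z) * α y z = α (x * y) z * α x y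

/-- Normalization `α(1,x) = α(x,1) = 1`. -/
def IsNormalized (α : G → G → kˣ) : Prop :=
  ∀ x : G, α 1 x = 1 ∧ α x 1 = 1

/-- `(L, R)` encode a `(k_αG, k_αG)`-bimodule structure on the `k`-module `M`:
`L g` is left multiplication by the basis element `ḡ` and `R g` is right
multiplication by `ḡ`. -/
def IsBimodule (α : G → G → kˣ) (L R : G → M →ₗ[k] M) : Prop :=
  (∀ m : M, L 1 m = m) ∧ (∀ m : M, R 1 m = m) ∧
  (∀ (g h : G) (m : M), L g (L h m) = (α g h : k) • L (g * h) m) ∧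
  (∀ (g h : G) (m : M), R h (R g m) = (α g h : k) • R (g * h) m) ∧
  (∀ (g h : G) (m : M), L g (R h m) = R h (L g m))

/-- The tuple of group elements appearing in the action of the transposition
`σ_{i0+1} = (i0+1, i0+2)` on `n`-cochains (0-indexed `i0 : Fin n`):
position `i0 - 1` gets `g_{i0-1}·g_{i0}`, position `i0` gets `g_{i0}⁻¹` and
position `i0 + 1` gets `g_{i0}·g_{i0+1}` (when these positions exist). -/
def swapTuple {n : ℕ} (i0 : Fin n) (g : Fin n → H) : Fin n → H := fun j =>
  if (j : ℕ) + 1 = (i0 : ℕ) then g j * g i0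
  else if j = i0 then (g i0)⁻¹
  else if (j : ℕ) = (i0 : ℕ) + 1 then g i0 * g j
  else g j

/-- The action of the transposition `σ_{i0+1} = (i0+1,i0+2) ∈ Σ_{n+1}` on Hochschild
`n`-cochains of the twisted group algebra `k_αG` with coefficients in the bimodule `M`.
All the `α`-scalars come from rewriting products and inverses of basis elements in
terms of basis elements: `ḡ·h̄ = α(g,h)·(gh)‾` and `ḡ⁻¹ = α(g,g⁻¹)⁻¹·(g⁻¹)‾`. -/
def hSigma (α : G → G → kˣ) (L R : G → M →ₗ[k] M) {n : ℕ} (i0 : Fin n)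
    (φ : (Fin n → G) → M) : (Fin n → G) → M := fun g =>
  -(((if 0 < (i0 : ℕ) then
        (α (g ⟨(i0 : ℕ) - 1, lt_of_le_of_lt (Nat.sub_le _ _) i0.isLt⟩) (g i0) : k) else 1) *
     (((α (g i0) (g i0)⁻¹)⁻¹ : kˣ) : k) *
     (if h : (i0 : ℕ) + 1 < n then (α (g i0) (g ⟨(i0 : ℕ) + 1, h⟩) : k) else 1)) •
    (if (i0 : ℕ) = 0 then
        L (g i0) (if (i0 : ℕ) + 1 = n then R (g i0) (φ (swapTuple i0 g)) else φ (swapTuple i0 g))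
      else (if (i0 : ℕ) + 1 = n then R (g i0) (φ (swapTuple i0 g)) else φ (swapTuple i0 g))))

/-- Staic's action of the transposition `σ_{i0+1} ∈ Σ_{n+1}` on group `n`-cochains
with values in an `H`-module `A`. -/
def gSigma {n : ℕ} (i0 : Fin n) (ψ : (Fin n → H) → A) : (Fin n → H) → A := fun h =>
  -(if (i0 : ℕ) = 0 then h i0 • ψ (swapTuple i0 h) else ψ (swapTuple i0 h))

/-- Staic's action of the transposition `σ_{i0+1} ∈ Σ_{n+1}` on group `n`-cochains
with values in the rank-one module `k` on which `H` acts through the character `χ`. -/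
def cSigma (χ : H → k) {n : ℕ} (i0 : Fin n) (ψ : (Fin n → H) → k) : (Fin n → H) → k := fun h =>
  -(if (i0 : ℕ) = 0 then χ (h i0) * ψ (swapTuple i0 h) else ψ (swapTuple i0 h))

/-- The `(n+1)`-tuple `g` with entries at positions `j, j+1` multiplied together. -/
def mergeAt {n : ℕ} (g : Fin (n + 1) → H) (j : Fin n) : Fin n → H := fun l =>
  if (l : ℕ) < (j : ℕ) then g (Fin.castSucc l)
  else if l = j then g (Fin.castSucc l) * g (Fin.succ l)
  else g (Fin.succ l)

/-- The Hochschild differential `δ^n` for the twisted group algebra `k_αG` with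
coefficients in the bimodule `M`, written on basis tensors (the scalar
`α(g_j, g_{j+1})` comes from `ḡ_j·ḡ_{j+1} = α(g_j,g_{j+1})·(g_jg_{j+1})‾`). -/
def hDiff (α : G → G → kˣ) (L R : G → M →ₗ[k] M) {n : ℕ}
    (φ : (Fin n → G) → M) : (Fin (n + 1) → G) → M := fun g =>
  L (g 0) (φ fun j => g j.succ)
    + ∑ j : Fin n, ((-1 : ℤ) ^ ((j : ℕ) + 1)) •
        ((α (g j.castSucc) (g j.succ) : k) • φ (mergeAt g j))
    + ((-1 : ℤ) ^ (n + 1)) • R (g (Fin.last n)) (φ fun j => g j.castSucc)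

/-- The group cohomology differential `∂^n` for cochains on `H` with values in the
`H`-module `A`. -/
def gDiff {n : ℕ} (ψ : (Fin n → H) → A) : (Fin (n + 1) → H) → A := fun h =>
  h 0 • ψ (fun j => h j.succ)
    + ∑ j : Fin n, ((-1 : ℤ) ^ ((j : ℕ) + 1)) • ψ (mergeAt h j)
    + ((-1 : ℤ) ^ (n + 1)) • ψ (fun j => h j.castSucc)

/-- The group cohomology differential `∂^n` for cochains on `H` with values in the
rank-one module `k` on which `H` acts through the character `χ`. -/
def cDiff (χ : H → k) {n : ℕ} (ψ : (Fin n → H) → k) : (Fin (n + 1) → H) → k := fun h =>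
  χ (h 0) * ψ (fun j => h j.succ)
    + ∑ j : Fin n, ((-1 : ℤ) ^ ((j : ℕ) + 1)) • ψ (mergeAt h j)
    + ((-1 : ℤ) ^ (n + 1)) • ψ (fun j => h j.castSucc)

/-- Left multiplication by the basis element `ḡ` on `k_αG` (modelled as `G → k`). -/
def Lmul (α : G → G → kˣ) (g : G) : (G → k) →ₗ[k] (G → k) where
  toFun a := fun y => (α g (g⁻¹ * y) : k) * a (g⁻¹ * y)
  map_add' a b := by funext y; simp [mul_add]
  map_smul' c a := by funext y; simp [smul_eq_mul]; ring

/-- Right multiplication by the basis element `ḡ` on `k_αG` (modelled as `G → k`). -/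
def Rmul (α : G → G → kˣ) (g : G) : (G → k) →ₗ[k] (G → k) where
  toFun a := fun y => (α (y * g⁻¹) g : k) * a (y * g⁻¹)
  map_add' a b := by funext y; simp [mul_add]
  map_smul' c a := by funext y; simp [smul_eq_mul]; ring

/-- Iterated right multiplication: `rmuls α [g₁,…,gₙ] v = v·ḡ₁·…·ḡₙ`. -/
def rmuls (α : G → G → kˣ) (l : List G) (v : G → k) : G → k :=
  l.foldl (fun w g => Rmul α g w) v

/-- Iterated right multiplication by inverses of basis elements:
`rinvs α [h₁,…,hₙ] v = v·h̄ₙ⁻¹·…·h̄₁⁻¹`, using `h̄⁻¹ = α(h,h⁻¹)⁻¹·(h⁻¹)‾`. -/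
def rinvs (α : G → G → kˣ) (l : List G) (v : G → k) : G → k :=
  l.foldr (fun h w => (((α h h⁻¹)⁻¹ : kˣ) : k) • Rmul α h⁻¹ w) v

/-- The character through which `h ∈ C_G(x)` acts on the module `k x̄`:
`χ(h) = α(h,x)·α(x,h)⁻¹`. -/
def chi (α : G → G → kˣ) (x : G) : G → k := fun h =>
  (α h x : k) * (((α x h)⁻¹ : kˣ) : k)

/-- The map `π^n_{G,x,α} : C^n(k_αG, k_αG) → C^n(C_G(x), k x̄)`: the value on
`(h₁,…,hₙ)` is the coefficient of the basis element `x̄` in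
`φ(h̄₁⊗…⊗h̄ₙ)·h̄ₙ⁻¹·…·h̄₁⁻¹` (identifying `k x̄` with `k`). -/
def piC (α : G → G → kˣ) (x : G) {n : ℕ} (φ : (Fin n → G) → (G → k)) :
    (Fin n → Subgroup.centralizer ({x} : Set G)) → k := fun h =>
  rinvs α (List.ofFn fun i => (h i : G)) (φ fun i => (h i : G)) x

/-- The same map as `piC` for a central element `x`, in which case `C_G(x) = G`:
`π^n_{G,x,α} : C^n(k_αG, k_αG) → C^n(G, k x̄)`. -/
def piZ (α : G → G → kˣ) (x : G) {n : ℕ} (φ : (Fin n → G) → (G → k)) :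
    (Fin n → G) → k := fun h =>
  rinvs α (List.ofFn h) (φ h) x

/-- The map `ν^n_{G,x,α} : C^n(G, k x̄) → C^n(k_αG, k_αG)` for `x ∈ Z(G)`:
`ψ ↦ (ḡ₁⊗…⊗ḡₙ ↦ ψ(g₁,…,gₙ)·x̄·ḡ₁·…·ḡₙ)` (identifying `k x̄` with `k`). -/
def nuZ (α : G → G → kˣ) (x : G) {n : ℕ} (ψ : (Fin n → G) → k) :
    (Fin n → G) → (G → k) := fun g =>
  ψ g • rmuls α (List.ofFn g) (Pi.single x 1)

/-- Iteration of the index map of a coset decomposition along a list of group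
elements: `chainIdx idx j [g₁,…,gᵢ]` is the index `s_j^i`. -/
def chainIdx {m : ℕ} (idx : Fin m → G → Fin m) (j : Fin m) : List G → Fin m
  | [] => j
  | a :: l => chainIdx idx (idx j a) l

/-- The map `ν^n_{G,x} : C^n(C_G(x), kx) → C^n(kG, kG)` for the (untwisted) group
algebra, relative to a right coset decomposition `G = ⋃ⱼ C_G(x)γⱼ`:
`ν(ψ)(g₁⊗…⊗gₙ) = Σⱼ ψ(h_{j,1},…,h_{j,n})·x⁻¹·xⱼ·g₁⋯gₙ` where
`xⱼ = γⱼ⁻¹xγⱼ`, the `h_{j,i} = rep (s_j^{i-1}) gᵢ ∈ C_G(x)` are determined by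
`γ_{s_j^{i-1}}·gᵢ = h_{j,i}·γ_{s_j^i}` and `kx` is identified with `k`. -/
def nuT (x : G) {m n : ℕ} (γ : Fin m → G) (idx : Fin m → G → Fin m)
    (rep : Fin m → G → G)
    (hrep : ∀ j a, rep j a ∈ Subgroup.centralizer ({x} : Set G))
    (ψ : (Fin n → Subgroup.centralizer ({x} : Set G)) → k) :
    (Fin n → G) → (G → k) := fun g =>
  ∑ j : Fin m,
    ψ (fun i => ⟨rep (chainIdx idx j ((List.ofFn g).take (i : ℕ))) (g i), hrep _ _⟩) •
      (Pi.single ((γ j)⁻¹ * x * γ j * (List.ofFn g).prod) (1 : k) : G → k)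

/-- `φ` is a Hochschild coboundary (for `n = 0` the coboundary space is `0`). -/
def IsHCoboundary (α : G → G → kˣ) (L R : G → M →ₗ[k] M) :
    ∀ {n : ℕ}, ((Fin n → G) → M) → Prop
  | 0, φ => φ = 0
  | _ + 1, φ => ∃ θ, φ = hDiff α L R θ

/-- `φ` is the Hochschild coboundary of a `Σ`-invariant cochain. -/
def IsHSCoboundary (α : G → G → kˣ) (L R : G → M →ₗ[k] M) :
    ∀ {n : ℕ}, ((Fin n → G) → M) → Prop
  | 0, φ => φ = 0
  | _ + 1, φ => ∃ θ, (∀ i0, hSigma α L R i0 θ = θ) ∧ φ = hDiff α L R θ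

/-- `ψ` is a group-cohomology coboundary (coefficients in `k` through `χ`). -/
def IsCCoboundary (χ : H → k) : ∀ {n : ℕ}, ((Fin n → H) → k) → Prop
  | 0, ψ => ψ = 0
  | _ + 1, ψ => ∃ θ, ψ = cDiff χ θ

/-- `ψ` is the coboundary of a `Σ`-invariant group cochain (coefficients through `χ`). -/
def IsCSCoboundary (χ : H → k) : ∀ {n : ℕ}, ((Fin n → H) → k) → Prop
  | 0, ψ => ψ = 0
  | _ + 1, ψ => ∃ θ, (∀ i0, cSigma χ i0 θ = θ) ∧ ψ = cDiff χ θ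

/-- `ψ` is a group-cohomology coboundary (coefficients in the `H`-module `A`). -/
def IsGCoboundary : ∀ {n : ℕ}, ((Fin n → H) → A) → Prop
  | 0, ψ => ψ = 0
  | _ + 1, ψ => ∃ θ, ψ = gDiff θ

/-- `ψ` is the coboundary of a `Σ`-invariant group cochain (coefficients in `A`). -/
def IsGSCoboundary : ∀ {n : ℕ}, ((Fin n → H) → A) → Prop
  | 0, ψ => ψ = 0
  | _ + 1, ψ => ∃ θ, (∀ i0, gSigma i0 θ = θ) ∧ ψ = gDiff θ

end Defs

theorem swapTuple_self {H : Type*} [Group H] {n : ℕ} (i : Fin n) (g : Fin n → H) :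
    swapTuple i g i = (g i)⁻¹ := by
  simp [swapTuple]

theorem swapTuple_of_val_add_one_eq {H : Type*} [Group H] {n : ℕ} {i j : Fin n}
    (h : (j : ℕ) + 1 = i) (g : Fin n → H) : swapTuple i g j = g j * g i := by
  simp [swapTuple, h]

theorem swapTuple_of_val_eq_add_one {H : Type*} [Group H] {n : ℕ} {i j : Fin n}
    (h : (j : ℕ) = i + 1) (g : Fin n → H) : swapTuple i g j = g i * g j := by
  have h₁ : (j : ℕ) + 1 ≠ i := by omega
  have h₂ : j ≠ i := fun e => by subst e; omega
  rw [swapTuple, if_neg h₁, if_neg h₂, if_pos h]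

theorem swapTuple_swapTuple {H : Type*} [Group H] {n : ℕ} (i : Fin n) (g : Fin n → H) :
    swapTuple i (swapTuple i g) = g := by
  funext j
  by_cases h₁ : (j : ℕ) + 1 = i
  · rw [swapTuple_of_val_add_one_eq h₁, swapTuple_of_val_add_one_eq h₁, swapTuple_self,
      mul_inv_cancel_right]
  by_cases h₂ : j = i
  · rw [h₂, swapTuple_self, swapTuple_self, inv_inv]
  by_cases h₃ : (j : ℕ) = i + 1
  · rw [swapTuple_of_val_eq_add_one h₃, swapTuple_of_val_eq_add_one h₃, swapTuple_self,
      inv_mul_cancel_left]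
  simp [swapTuple, h₁, h₂, h₃]

section Cocycle

variable {k : Type*} [CommRing k] {G : Type*} [Group G] {α : G → G → kˣ}

theorem IsCocycle.mul_inv_left (hα : IsCocycle α) (hnorm : IsNormalized α) (a b : G) :
    α a b * α a⁻¹ (a * b) = α a⁻¹ a := by
  have h := hα a⁻¹ a b
  rwa [inv_mul_cancel, (hnorm b).1, one_mul, mul_comm] at h

theorem IsCocycle.mul_inv_right (hα : IsCocycle α) (hnorm : IsNormalized α) (c a : G) :
    α c a * α (c * a) a⁻¹ = α a a⁻¹ := by
  have h := hα c a a⁻¹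
  rwa [mul_inv_cancel, (hnorm c).2, one_mul, mul_comm, eq_comm] at h

theorem IsCocycle.inv_comm (hα : IsCocycle α) (hnorm : IsNormalized α) (a : G) :
    α a⁻¹ a = α a a⁻¹ := by
  have h := hα a a⁻¹ a
  rwa [inv_mul_cancel, mul_inv_cancel, (hnorm a).1, (hnorm a).2, one_mul, one_mul] at h

end Cocycle

/-- each transposition operator `σ_i` on `C^n(k_αG, M)` is an involution. -/
theorem sigma_involutive
    {k : Type*} [Field k] {G : Type*} [Group G] [Fintype G] [DecidableEq G]
    {M : Type*} [AddCommGroup M] [Module k M]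
    (α : G → G → kˣ) (hα : IsCocycle α) (hnorm : IsNormalized α)
    (L R : G → M →ₗ[k] M) (hbim : IsBimodule α L R)
    {n : ℕ} (hn : 1 ≤ n) (i0 : Fin n) (φ : (Fin n → G) → M) :
    hSigma α L R i0 (hSigma α L R i0 φ) = φ := by
  obtain ⟨hL, hR, hLL, hRR, hLR⟩ := hbim
  funext g
  have hLinv (m : M) : L (g i0) (L (g i0)⁻¹ m) = (α (g i0) (g i0)⁻¹ : k) • m := by
    rw [hLL, mul_inv_cancel, hL]
  have hRinv (m : M) : R (g i0) (R (g i0)⁻¹ m) = (α (g i0) (g i0)⁻¹ : k) • m := by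
    rw [hRR, inv_mul_cancel, hR, hα.inv_comm hnorm]
  have hl (b : G) : (α (g i0) b : k) * α (g i0)⁻¹ (g i0 * b) = α (g i0) (g i0)⁻¹ := by
    rw [← hα.inv_comm hnorm, ← hα.mul_inv_left hnorm (g i0) b, Units.val_mul]
  have hr (c : G) : (α c (g i0) : k) * α (c * g i0) (g i0)⁻¹ = α (g i0) (g i0)⁻¹ := by
    rw [← hα.mul_inv_right hnorm c (g i0), Units.val_mul]
  have hu : (α (g i0) (g i0)⁻¹ : k) ≠ 0 := Units.ne_zero _
  simp only [hSigma, swapTuple_self, swapTuple_swapTuple, inv_inv, hα.inv_comm hnorm,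
    Units.val_inv_eq_inv_val]
  by_cases h₀ : (i0 : ℕ) = 0 <;> by_cases h₁ : (i0 : ℕ) + 1 = n
  · have h₂ : ¬ (i0 : ℕ) + 1 < n := by omega
    simp only [if_pos h₀, if_pos h₁, dif_neg h₂, if_neg (Nat.not_lt.mpr h₀.le), map_neg, map_smul,
      smul_neg, neg_neg, smul_smul, ← hLR, hLinv, hRinv, one_mul, mul_one]
    convert one_smul k (φ g) using 2
    field_simp
  · have h₂ : (i0 : ℕ) + 1 < n := by omega
    simp only [if_pos h₀, if_neg h₁, dif_pos h₂, if_neg (Nat.not_lt.mpr h₀.le), map_neg, map_smul,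
      smul_neg, neg_neg, smul_smul, hLinv, one_mul]
    rw [swapTuple_of_val_eq_add_one rfl]
    convert one_smul k (φ g) using 2
    have := hl (g ⟨i0 + 1, h₂⟩)
    field_simp
    exact this
  · have h₂ : ¬ (i0 : ℕ) + 1 < n := by omega
    simp only [if_neg h₀, if_pos h₁, dif_neg h₂, if_pos (Nat.pos_of_ne_zero h₀), map_neg, map_smul,
      smul_neg, neg_neg, smul_smul, hRinv, mul_one]
    rw [swapTuple_of_val_add_one_eq (Nat.sub_add_cancel (Nat.pos_of_ne_zero h₀))]
    convert one_smul k (φ g) using 2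
    have := hr (g ⟨i0 - 1, by omega⟩)
    field_simp
    exact this
  · have h₂ : (i0 : ℕ) + 1 < n := by omega
    simp only [if_neg h₀, if_neg h₁, dif_pos h₂, if_pos (Nat.pos_of_ne_zero h₀),
      smul_neg, neg_neg, smul_smul]
    rw [swapTuple_of_val_add_one_eq (Nat.sub_add_cancel (Nat.pos_of_ne_zero h₀)),
      swapTuple_of_val_eq_add_one rfl]
    convert one_smul k (φ g) using 2
    have hl' := hl (g ⟨i0 + 1, h₂⟩)
    have hr' := hr (g ⟨i0 - 1, by omega⟩)
    field_simp
    linear_combination (α (g i0) (g i0)⁻¹ : k) * hl' + (α (g i0) (g ⟨i0 + 1, h₂⟩) : k) *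
      α (g i0)⁻¹ (g i0 * g ⟨i0 + 1, h₂⟩) * hr'

end TwistedSym
end

section
/- Let n ≥ 1 and i,j ∈ {1,…,n} with |i−j| ≥ 2. Then σ_i(σ_j(φ)) = σ_j(σ_i(φ)) for every φ ∈ C^n(k_αG,M). Consequently, together with the relations σ_i² = id and σ_iσ_{i+1}σ_i = σ_{i+1}σ_iσ_{i+1}, the operators σ_1,…,σ_n define an action of the symmetric group Σ_{n+1} on C^n(k_αG,M) via its Coxeter presentation. -/
/- Common setup: twisted group algebras modelled on their canonical basis.
An element of the twisted group algebra `k_αG` is modelled as a function `G → k`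
(its coordinates in the basis `{ḡ : g ∈ G}`), and a Hochschild `n`-cochain
`Hom_k((k_αG)^{⊗n}, M)` is modelled by its values on basis tensors, i.e. as a
function `(Fin n → G) → M`.  Similarly a group cochain `C^n(H, A)` is a function
`(Fin n → H) → A`; the one-dimensional module `k x̄` is modelled as `k` with the
action of `h` given by multiplication by the character `χ(h) = α(h,x)·α(x,h)⁻¹`. -/

namespace TwistedSym

section Homogenization

variable {k : Type*} [Field k] {G : Type*} [Group G]
variable {M : Type*} [AddCommGroup M] [Module k M]

/-- The tuple of quotients `xⱼ⁻¹xⱼ₊₁` of consecutive entries. -/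
def quotients {n : ℕ} (x : Fin (n + 1) → G) : Fin n → G := fun j =>
  (x j.castSucc)⁻¹ * x j.succ

/-- The scalar `a` with `x̄⁻¹·ȳ = a⁻¹·(x⁻¹y)‾`. -/
def quotScalar (α : G → G → kˣ) (x y : G) : kˣ := α x (x⁻¹ * y)

/-- Right multiplication by `x̄⁻¹`. -/
def rightInv (α : G → G → kˣ) (R : G → M →ₗ[k] M) (x : G) (m : M) : M :=
  (α x x⁻¹)⁻¹ • R x⁻¹ m

/-- The homogeneous form of a cochain:
`(x₀,…,xₙ) ↦ x̄₀·φ(x̄₀⁻¹x̄₁ ⊗ … ⊗ x̄ₙ₋₁⁻¹x̄ₙ)·x̄ₙ⁻¹`. -/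
def homogenize (α : G → G → kˣ) (L R : G → M →ₗ[k] M) {n : ℕ}
    (φ : (Fin n → G) → M) (x : Fin (n + 1) → G) : M :=
  (∏ j : Fin n, quotScalar α (x j.castSucc) (x j.succ))⁻¹ •
    L (x 0) (rightInv α R (x (Fin.last n)) (φ (quotients x)))

/-- The exchange of positions `i, i+1` of an `(n+1)`-tuple. -/
def adjSwap {n : ℕ} (i : Fin n) : Equiv.Perm (Fin (n + 1)) := Equiv.swap i.castSucc i.succ

lemma map_units_smul (f : M →ₗ[k] M) (u : kˣ) (m : M) : f (u • m) = u • f m := by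
  simp [Units.smul_def]

lemma IsCocycle.quotScalar_mul {α : G → G → kˣ} (hα : IsCocycle α) (x y z : G) :
    quotScalar α x z * α (x⁻¹ * y) (y⁻¹ * z) = quotScalar α x y * quotScalar α y z := by
  have h := hα x (x⁻¹ * y) (y⁻¹ * z)
  have e1 : x⁻¹ * y * (y⁻¹ * z) = x⁻¹ * z := by group
  have e2 : x * (x⁻¹ * y) = y := by group
  rw [e1, e2] at h
  rw [quotScalar, h, mul_comm]; rfl

lemma IsCocycle.quotScalar_mul_swap {α : G → G → kˣ} (hα : IsCocycle α) (hnorm : IsNormalized α)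
    (x y : G) :
    quotScalar α x y * quotScalar α y x = α (x⁻¹ * y) (x⁻¹ * y)⁻¹ := by
  rw [← hα.quotScalar_mul x y x]
  simp [quotScalar, (hnorm x).2]

lemma adjSwap_apply {n : ℕ} (i : Fin n) (l : Fin (n + 1)) :
    adjSwap i l = if (l : ℕ) = i then i.succ else if (l : ℕ) = i + 1 then i.castSucc else l := by
  simp [adjSwap, Equiv.swap_apply_def, Fin.ext_iff]

lemma quotients_comp_adjSwap {n : ℕ} (i : Fin n) (x : Fin (n + 1) → G) :
    quotients (x ∘ adjSwap i) = swapTuple i (quotients x) := by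
  funext j
  simp only [quotients, swapTuple, Function.comp, adjSwap_apply, Fin.val_castSucc, Fin.val_succ,
    Fin.ext_iff]
  by_cases h1 : (j : ℕ) + 1 = i
  · have : i.castSucc = j.succ := by ext; simp [h1]
    have h2 : (j : ℕ) ≠ i := by omega
    have h3 : (j : ℕ) ≠ i + 1 := by omega
    simp [h1, h2, h3, this]
  by_cases h2 : (j : ℕ) = i
  · obtain rfl := Fin.ext h2
    simp
  by_cases h3 : (j : ℕ) = i + 1
  · have : j.castSucc = i.succ := by ext; simp [h3]
    have h4 : (j : ℕ) + 1 ≠ i + 1 := by omega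
    have h5 : (i : ℕ) + 1 + 1 ≠ i := by omega
    simp [h3, h5, this]
  · simp [h1, h2, h3]

lemma prod_ite_val_succ_eq {N : Type*} [CommMonoid N] {n : ℕ} (i : Fin n) (f : Fin n → N) :
    (∏ j : Fin n, if (j : ℕ) + 1 = i then f j else 1) =
      if 0 < (i : ℕ) then f ⟨(i : ℕ) - 1, lt_of_le_of_lt (Nat.sub_le _ _) i.isLt⟩ else 1 := by
  split_ifs with h
  · rw [Finset.prod_eq_single ⟨(i : ℕ) - 1, lt_of_le_of_lt (Nat.sub_le _ _) i.isLt⟩]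
    · rw [if_pos]; simp; omega
    · intro b _ hb
      rw [if_neg]
      intro hh
      exact hb (Fin.ext (by simp; omega))
    · simp
  · exact Finset.prod_eq_one fun j _ => if_neg (by omega)

lemma prod_ite_val_eq_succ {N : Type*} [CommMonoid N] {n : ℕ} (i : Fin n) (f : Fin n → N) :
    (∏ j : Fin n, if (j : ℕ) = i + 1 then f j else 1) =
      if h : (i : ℕ) + 1 < n then f ⟨(i : ℕ) + 1, h⟩ else 1 := by
  split_ifs with h
  · rw [Finset.prod_eq_single ⟨(i : ℕ) + 1, h⟩]
    · simp
    · intro b _ hb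
      rw [if_neg]
      intro hh
      exact hb (Fin.ext hh)
    · simp
  · exact Finset.prod_eq_one fun j _ => if_neg (by omega)

lemma IsCocycle.prod_quotScalar_comp_adjSwap {α : G → G → kˣ} (hα : IsCocycle α)
    (hnorm : IsNormalized α) {n : ℕ} (i : Fin n) (x : Fin (n + 1) → G) :
    (∏ j : Fin n, quotScalar α ((x ∘ adjSwap i) j.castSucc) ((x ∘ adjSwap i) j.succ)) *
      ((if 0 < (i : ℕ) then α (quotients x ⟨(i : ℕ) - 1,
          lt_of_le_of_lt (Nat.sub_le _ _) i.isLt⟩) (quotients x i) else 1) *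
        (α (quotients x i) (quotients x i)⁻¹)⁻¹ *
        (if h : (i : ℕ) + 1 < n then α (quotients x i) (quotients x ⟨(i : ℕ) + 1, h⟩) else 1)) *
      ((if (i : ℕ) = 0 then quotScalar α (x i.castSucc) (x i.succ) else 1) *
        (if (i : ℕ) + 1 = n then quotScalar α (x i.castSucc) (x i.succ) else 1)) =
      ∏ j : Fin n, quotScalar α (x j.castSucc) (x j.succ) := by
  set a := quotScalar α (x i.castSucc) (x i.succ) with ha
  have key : ∀ j : Fin n,
      quotScalar α ((x ∘ adjSwap i) j.castSucc) ((x ∘ adjSwap i) j.succ) *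
        ((if (j : ℕ) + 1 = i then α (quotients x j) (quotients x i) * a⁻¹ else 1) *
         (if j = i then (α (quotients x i) (quotients x i)⁻¹)⁻¹ * (a * a) else 1) *
         (if (j : ℕ) = i + 1 then α (quotients x i) (quotients x j) * a⁻¹ else 1)) =
      quotScalar α (x j.castSucc) (x j.succ) := by
    intro j
    simp only [Function.comp, adjSwap_apply, Fin.val_castSucc, Fin.val_succ, Fin.ext_iff]
    by_cases h1 : (j : ℕ) + 1 = i
    · have e : i.castSucc = j.succ := by ext; simp [h1]
      have h2 : (j : ℕ) ≠ i := by omega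
      have h3 : (j : ℕ) ≠ i + 1 := by omega
      simp only [h1, h2, h3, if_true, if_false, mul_one]
      rw [← mul_assoc, mul_inv_eq_iff_eq_mul, ha, e, quotients, quotients, e]
      exact hα.quotScalar_mul _ _ _
    by_cases h2 : (j : ℕ) = i
    · obtain rfl := Fin.ext h2
      have h3 : (j : ℕ) + 1 ≠ j := by omega
      have h4 : (j : ℕ) ≠ j + 1 := by omega
      simp only [h3, h4, if_true, if_false, mul_one, one_mul]
      have := hα.quotScalar_mul_swap hnorm (x j.castSucc) (x j.succ)
      rw [quotients, ← this, ← ha, mul_inv]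
      generalize quotScalar α (x j.succ) (x j.castSucc) = b
      rw [show b * (a⁻¹ * b⁻¹ * (a * a)) = (b * b⁻¹) * (a⁻¹ * a) * a by ac_rfl]
      simp
    by_cases h3 : (j : ℕ) = i + 1
    · have e : j.castSucc = i.succ := by ext; simp [h3]
      have h4 : (j : ℕ) + 1 ≠ i + 1 := by omega
      have h5 : (j : ℕ) + 1 ≠ i := h1
      have h6 : (j : ℕ) ≠ i := h2
      simp only [h4, h5, h6, if_false, one_mul, if_pos h3]
      rw [← mul_assoc, mul_inv_eq_iff_eq_mul, ha, e, quotients, quotients, e, mul_comm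
        (quotScalar α (x i.succ) _)]
      exact hα.quotScalar_mul _ _ _
    · simp [h1, h2, h3]
  rw [← Finset.prod_congr rfl fun j _ => key j]
  simp only [Finset.prod_mul_distrib]
  rw [prod_ite_val_succ_eq i fun j => α (quotients x j) (quotients x i) * a⁻¹,
    prod_ite_val_eq_succ i fun j => α (quotients x i) (quotients x j) * a⁻¹,
    Finset.prod_ite_eq' Finset.univ i, if_pos (Finset.mem_univ i)]
  generalize (∏ j : Fin n, quotScalar α ((x ∘ adjSwap i) j.castSucc)
    ((x ∘ adjSwap i) j.succ)) = P
  have hl : ∀ b : kˣ, (if 0 < (i : ℕ) then b else 1) * (if (i : ℕ) = 0 then a else 1) =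
      (if 0 < (i : ℕ) then b * a⁻¹ else 1) * a := by
    intro b
    split_ifs <;> first | omega | simp
  have hr : (if h : (i : ℕ) + 1 < n then α (quotients x i) (quotients x ⟨(i : ℕ) + 1, h⟩) else 1) *
      (if (i : ℕ) + 1 = n then a else 1) =
      (if h : (i : ℕ) + 1 < n then
        α (quotients x i) (quotients x ⟨(i : ℕ) + 1, h⟩) * a⁻¹ else 1) * a := by
    have := i.isLt
    split_ifs <;> first | omega | simp
  have regroup : ∀ A B C E F A' C' : kˣ, A * E = A' * a → C * F = C' * a →
      P * (A * B * C) * (E * F) = P * (A' * (B * (a * a)) * C') := by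
    intro A B C E F A' C' h1 h2
    calc P * (A * B * C) * (E * F) = P * B * (A * E) * (C * F) := by ac_rfl
      _ = P * (A' * (B * (a * a)) * C') := by rw [h1, h2]; ac_rfl
  exact regroup _ _ _ _ _ _ _ (hl _) hr

lemma hSigma_apply_eq_units_smul [DecidableEq G] (α : G → G → kˣ) (L R : G → M →ₗ[k] M) {n : ℕ}
    (i : Fin n) (φ : (Fin n → G) → M) (g : Fin n → G) :
    hSigma α L R i φ g =
      -(((if 0 < (i : ℕ) then α (g ⟨(i : ℕ) - 1,
          lt_of_le_of_lt (Nat.sub_le _ _) i.isLt⟩) (g i) else 1) *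
        (α (g i) (g i)⁻¹)⁻¹ *
        (if h : (i : ℕ) + 1 < n then α (g i) (g ⟨(i : ℕ) + 1, h⟩) else 1)) •
      (if (i : ℕ) = 0 then L (g i) else LinearMap.id)
        ((if (i : ℕ) + 1 = n then R (g i) else LinearMap.id) (φ (swapTuple i g)))) := by
  rw [hSigma, Units.smul_def]
  split_ifs <;> simp

lemma IsBimodule.left_mul_quotient {α : G → G → kˣ} {L R : G → M →ₗ[k] M}
    (hbim : IsBimodule α L R) (x y : G) (m : M) :
    L x (L (x⁻¹ * y) m) = quotScalar α x y • L y m := by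
  rw [hbim.2.2.1, mul_inv_cancel_left]; rfl

lemma IsBimodule.rightInv_right {α : G → G → kˣ} {L R : G → M →ₗ[k] M} (hbim : IsBimodule α L R) (x : G) (m : M) :
    rightInv α R x (R x m) = m := by
  rw [rightInv, hbim.2.2.2.1, mul_inv_cancel, hbim.2.1, ← Units.smul_def, inv_smul_smul]

lemma IsBimodule.right_rightInv {α : G → G → kˣ} (hα : IsCocycle α) (hnorm : IsNormalized α)
    {L R : G → M →ₗ[k] M} (hbim : IsBimodule α L R) (x : G) (m : M) :
    R x (rightInv α R x m) = m := by
  have h := hα x x⁻¹ x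
  simp only [inv_mul_cancel, mul_inv_cancel, (hnorm x).1, (hnorm x).2, one_mul] at h
  rw [rightInv, map_units_smul, hbim.2.2.2.1, inv_mul_cancel, hbim.2.1, ← Units.smul_def, h,
    inv_smul_smul]

lemma IsBimodule.rightInv_quotient {α : G → G → kˣ} (hα : IsCocycle α) (hnorm : IsNormalized α)
    {L R : G → M →ₗ[k] M} (hbim : IsBimodule α L R) (x y : G) (m : M) :
    rightInv α R y (R (x⁻¹ * y) m) = quotScalar α x y • rightInv α R x m := by
  obtain ⟨m, rfl⟩ : ∃ m', m = R x m' := ⟨_, (hbim.right_rightInv hα hnorm x m).symm⟩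
  rw [hbim.rightInv_right, hbim.2.2.2.1, mul_inv_cancel_left, ← Units.smul_def, rightInv,
    map_units_smul, smul_comm]
  exact congrArg _ (hbim.rightInv_right y m)

lemma rightInv_units_smul (α : G → G → kˣ) (R : G → M →ₗ[k] M) (x : G) (u : kˣ) (m : M) :
    rightInv α R x (u • m) = u • rightInv α R x m := by
  rw [rightInv, map_units_smul, smul_comm]; rfl

lemma rightInv_neg (α : G → G → kˣ) (R : G → M →ₗ[k] M) (x : G) (m : M) :
    rightInv α R x (-m) = -rightInv α R x m := by
  simp [rightInv]

lemma IsBimodule.left_rightInv {α : G → G → kˣ} {L R : G → M →ₗ[k] M}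
    (hbim : IsBimodule α L R) (x y : G) (m : M) :
    L x (rightInv α R y m) = rightInv α R y (L x m) := by
  rw [rightInv, map_units_smul, hbim.2.2.2.2]; rfl

lemma IsBimodule.left_injective {α : G → G → kˣ} {L R : G → M →ₗ[k] M}
    (hbim : IsBimodule α L R) (x : G) : Function.Injective (L x) := by
  intro m m' h
  have h' := congrArg (L x⁻¹) h
  rwa [hbim.2.2.1, hbim.2.2.1, inv_mul_cancel, hbim.1, hbim.1, ← Units.smul_def,
    ← Units.smul_def, smul_left_cancel_iff] at h'

/-- On homogeneous cochains `σ` acts by exchanging two adjacent arguments, up to sign. -/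
lemma homogenize_hSigma [DecidableEq G] {α : G → G → kˣ} (hα : IsCocycle α)
    (hnorm : IsNormalized α) {L R : G → M →ₗ[k] M} (hbim : IsBimodule α L R) {n : ℕ}
    (i : Fin n) (φ : (Fin n → G) → M) (x : Fin (n + 1) → G) :
    homogenize α L R (hSigma α L R i φ) x = -homogenize α L R φ (x ∘ adjSwap i) := by
  have hL : ∀ m : M, L (x 0) ((if (i : ℕ) = 0 then L (quotients x i) else LinearMap.id) m) =
      (if (i : ℕ) = 0 then quotScalar α (x i.castSucc) (x i.succ) else 1) •
        L ((x ∘ adjSwap i) 0) m := by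
    intro m
    by_cases h : (i : ℕ) = 0
    · have e : (0 : Fin (n + 1)) = i.castSucc := by ext; simp [h]
      rw [if_pos h, if_pos h, Function.comp_apply, e, adjSwap, Equiv.swap_apply_left]
      exact hbim.left_mul_quotient _ _ _
    · have e : adjSwap i 0 = 0 := by
        rw [adjSwap_apply, if_neg (by simpa using Ne.symm h), if_neg (by simp)]
      rw [if_neg h, if_neg h, Function.comp_apply, e, one_smul, LinearMap.id_apply]
  have hR : ∀ m : M, rightInv α R (x (Fin.last n))
        ((if (i : ℕ) + 1 = n then R (quotients x i) else LinearMap.id) m) =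
      (if (i : ℕ) + 1 = n then quotScalar α (x i.castSucc) (x i.succ) else 1) •
        rightInv α R ((x ∘ adjSwap i) (Fin.last n)) m := by
    intro m
    by_cases h : (i : ℕ) + 1 = n
    · have e : Fin.last n = i.succ := by ext; simp [h]
      rw [if_pos h, if_pos h, Function.comp_apply, e, adjSwap, Equiv.swap_apply_right]
      exact hbim.rightInv_quotient hα hnorm _ _ _
    · have e : adjSwap i (Fin.last n) = Fin.last n := by
        rw [adjSwap_apply, if_neg (by simpa using i.isLt.ne'), if_neg (by simpa using Ne.symm h)]
      rw [if_neg h, if_neg h, Function.comp_apply, e, one_smul, LinearMap.id_apply]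
  rw [homogenize, homogenize, hSigma_apply_eq_units_smul, rightInv_neg, map_neg, smul_neg,
    rightInv_units_smul, map_units_smul, quotients_comp_adjSwap,
    ← hα.prod_quotScalar_comp_adjSwap hnorm i x, hbim.left_rightInv, hL, rightInv_units_smul,
    ← hbim.left_rightInv, hR, map_units_smul]
  simp only [smul_smul]
  congr 2
  rw [mul_assoc (∏ _, _), inv_mul_eq_iff_eq_mul, mul_inv_cancel_comm]

lemma homogenize_injective {α : G → G → kˣ} (hα : IsCocycle α) (hnorm : IsNormalized α)
    {L R : G → M →ₗ[k] M} (hbim : IsBimodule α L R) {n : ℕ} :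
    Function.Injective (homogenize α L R : ((Fin n → G) → M) → (Fin (n + 1) → G) → M) := by
  intro φ ψ h
  funext g
  have hq : quotients (Fin.partialProd g) = g := funext fun j => Fin.partialProd_right_inv g j
  have h1 := congrFun h (Fin.partialProd g)
  rw [homogenize, homogenize, smul_left_cancel_iff, hq] at h1
  have h2 := congrArg (R (Fin.partialProd g (Fin.last n))) (hbim.left_injective _ h1)
  rwa [hbim.right_rightInv hα hnorm, hbim.right_rightInv hα hnorm] at h2

lemma exists_homogenize_eq_sign_smul [DecidableEq G] {α : G → G → kˣ} (hα : IsCocycle α)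
    (hnorm : IsNormalized α) {L R : G → M →ₗ[k] M} (hbim : IsBimodule α L R) {n : ℕ}
    (w : Equiv.Perm (Fin (n + 1))) (φ : (Fin n → G) → M) :
    ∃ ψ : (Fin n → G) → M, ∀ x : Fin (n + 1) → G,
      homogenize α L R ψ x = Equiv.Perm.sign w • homogenize α L R φ (x ∘ w) := by
  have hw : w ∈ Submonoid.closure
      (Set.range fun i : Fin n => Equiv.swap i.castSucc i.succ) := by
    rw [Equiv.Perm.mclosure_swap_castSucc_succ]; trivial
  induction hw using Submonoid.closure_induction generalizing φ with
  | mem w h =>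
    obtain ⟨i, rfl⟩ := h
    refine ⟨hSigma α L R i φ, fun x => ?_⟩
    rw [homogenize_hSigma hα hnorm hbim, Equiv.Perm.sign_swap i.castSucc_lt_succ.ne]
    simp [adjSwap]
  | one => exact ⟨φ, fun x => by simp⟩
  | mul v w _ _ hv hw =>
    obtain ⟨ψ, hψ⟩ := hw φ
    obtain ⟨θ, hθ⟩ := hv ψ
    refine ⟨θ, fun x => ?_⟩
    rw [hθ, hψ, Equiv.Perm.sign_mul, mul_smul, Equiv.Perm.coe_mul, Function.comp_assoc]

/-- The action of the symmetric group on inhomogeneous cochains. -/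
noncomputable def permAction [DecidableEq G] {α : G → G → kˣ} (hα : IsCocycle α)
    (hnorm : IsNormalized α) {L R : G → M →ₗ[k] M} (hbim : IsBimodule α L R) (n : ℕ) :
    Equiv.Perm (Fin (n + 1)) →* Function.End ((Fin n → G) → M) where
  toFun w := fun φ => (exists_homogenize_eq_sign_smul hα hnorm hbim w φ).choose
  map_one' := by
    funext φ
    apply homogenize_injective hα hnorm hbim
    funext x
    rw [(exists_homogenize_eq_sign_smul hα hnorm hbim 1 φ).choose_spec]
    simp only [Equiv.Perm.sign_one, one_smul, Equiv.Perm.coe_one, Function.comp_id]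
    rfl
  map_mul' v w := by
    funext φ
    apply homogenize_injective hα hnorm hbim
    funext x
    rw [(exists_homogenize_eq_sign_smul hα hnorm hbim (v * w) φ).choose_spec]
    refine Eq.trans ?_ ((exists_homogenize_eq_sign_smul hα hnorm hbim v _).choose_spec x).symm
    rw [(exists_homogenize_eq_sign_smul hα hnorm hbim w φ).choose_spec, Equiv.Perm.sign_mul,
      mul_smul, Equiv.Perm.coe_mul, Function.comp_assoc]

lemma permAction_adjSwap [DecidableEq G] {α : G → G → kˣ} (hα : IsCocycle α)
    (hnorm : IsNormalized α) {L R : G → M →ₗ[k] M} (hbim : IsBimodule α L R) {n : ℕ}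
    (i : Fin n) : permAction hα hnorm hbim n (adjSwap i) = hSigma α L R i := by
  funext φ
  apply homogenize_injective hα hnorm hbim
  funext x
  rw [homogenize_hSigma hα hnorm hbim]
  refine ((exists_homogenize_eq_sign_smul hα hnorm hbim _ φ).choose_spec x).trans ?_
  rw [adjSwap, Equiv.Perm.sign_swap i.castSucc_lt_succ.ne]
  simp

lemma adjSwap_commute {n : ℕ} {i j : Fin n}
    (h : (i : ℕ) + 2 ≤ (j : ℕ) ∨ (j : ℕ) + 2 ≤ (i : ℕ)) : Commute (adjSwap i) (adjSwap j) := by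
  apply Equiv.Perm.Disjoint.commute
  apply Equiv.Perm.disjoint_swap_swap
  simp [Fin.ext_iff]
  omega

end Homogenization

/-- distant transpositions commute (`σ_i σ_j = σ_j σ_i` for `|i-j| ≥ 2`);
consequently, together with `σ_i² = id` and the braid relations, the operators
`σ_1, …, σ_n` define an action of the symmetric group `Σ_{n+1}` on `C^n(k_αG, M)`
via its Coxeter presentation, i.e. there is a monoid homomorphism
`Σ_{n+1} → End(C^n(k_αG,M))` sending the transposition `(i, i+1)` to `σ_i`. -/
theorem sigma_commute_and_action
    {k : Type*} [Field k] {G : Type*} [Group G] [Fintype G] [DecidableEq G]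
    {M : Type*} [AddCommGroup M] [Module k M]
    (α : G → G → kˣ) (hα : IsCocycle α) (hnorm : IsNormalized α)
    (L R : G → M →ₗ[k] M) (hbim : IsBimodule α L R)
    {n : ℕ} (hn : 1 ≤ n) :
    (∀ i0 j0 : Fin n, ((i0 : ℕ) + 2 ≤ (j0 : ℕ) ∨ (j0 : ℕ) + 2 ≤ (i0 : ℕ)) →
      ∀ φ : (Fin n → G) → M,
        hSigma α L R i0 (hSigma α L R j0 φ) = hSigma α L R j0 (hSigma α L R i0 φ)) ∧
    ∃ ρ : Equiv.Perm (Fin (n + 1)) →* Function.End ((Fin n → G) → M),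
      ∀ i0 : Fin n, ρ (Equiv.swap i0.castSucc i0.succ) = hSigma α L R i0 := by
  have hρ := permAction_adjSwap hα hnorm hbim (n := n)
  refine ⟨fun i j hij φ => ?_, permAction hα hnorm hbim n, hρ⟩
  have h := congrArg (permAction hα hnorm hbim n) (adjSwap_commute hij).eq
  rw [map_mul, map_mul, hρ, hρ] at h
  exact congrFun h φ

end TwistedSym
end

section
/- Let n ≥ 1 and x ∈ G. Then π^n_{G,x,α} ∘ δ^{n−1} = ∂^{n−1} ∘ π^{n−1}_{G,x,α} as maps C^{n−1}(k_αG,k_αG) → C^n(C_G(x), k x̄); that is, the maps π^*_{G,x,α} commute with the Hochschild differential δ^* and the group-cohomology differential ∂^*. -/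
/- Common setup: twisted group algebras modelled on their canonical basis.
An element of the twisted group algebra `k_αG` is modelled as a function `G → k`
(its coordinates in the basis `{ḡ : g ∈ G}`), and a Hochschild `n`-cochain
`Hom_k((k_αG)^{⊗n}, M)` is modelled by its values on basis tensors, i.e. as a
function `(Fin n → G) → M`.  Similarly a group cochain `C^n(H, A)` is a function
`(Fin n → H) → A`; the one-dimensional module `k x̄` is modelled as `k` with the
action of `h` given by multiplication by the character `χ(h) = α(h,x)·α(x,h)⁻¹`. -/

namespace TwistedSym

section RightInverse

variable {k : Type*} [CommRing k] {G : Type*} [Group G]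

theorem rinvs_cons (α : G → G → kˣ) (hα : IsCocycle α) (hnorm : IsNormalized α)
    (h : G) (l : List G) (v : G → k) (y : G) :
    rinvs α (h :: l) v y = (((α y h)⁻¹ : kˣ) : k) * rinvs α l v (y * h) := by
  have hc := hα y h h⁻¹
  rw [mul_inv_cancel, (hnorm y).2, one_mul] at hc
  have hu : (α h h⁻¹)⁻¹ * α (y * h) h⁻¹ = (α y h)⁻¹ := by
    rw [hc, mul_inv, mul_right_comm, inv_mul_cancel, one_mul]
  simp only [← hu, Units.val_mul]
  simp [rinvs, Rmul, mul_assoc]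

theorem rinvs_add (α : G → G → kˣ) (l : List G) (v w : G → k) :
    rinvs α l (v + w) = rinvs α l v + rinvs α l w := by
  induction l with
  | nil => rfl
  | cons h l ih =>
    simp only [rinvs, List.foldr_cons] at ih ⊢
    rw [ih, map_add, smul_add]

theorem rinvs_smul (α : G → G → kˣ) (l : List G) (c : k) (v : G → k) :
    rinvs α l (c • v) = c • rinvs α l v := by
  induction l with
  | nil => rfl
  | cons h l ih =>
    simp only [rinvs, List.foldr_cons] at ih ⊢
    rw [ih, map_smul, smul_comm]

/-- Iterated right multiplication by inverses of basis elements, as a linear map. -/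
def rinvsLinear (α : G → G → kˣ) (l : List G) : (G → k) →ₗ[k] (G → k) where
  toFun := rinvs α l
  map_add' := rinvs_add α l
  map_smul' := rinvs_smul α l

theorem rinvs_append (α : G → G → kˣ) (l l' : List G) (v : G → k) :
    rinvs α (l ++ l') v = rinvs α l (rinvs α l' v) := by
  simp [rinvs]

theorem rinvs_singleton_Rmul (α : G → G → kˣ) (hα : IsCocycle α) (hnorm : IsNormalized α)
    (g : G) (v : G → k) : rinvs α [g] (Rmul α g v) = v := by
  funext y
  rw [rinvs_cons α hα hnorm]
  simp [rinvs, Rmul]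

theorem rinvs_Lmul (α : G → G → kˣ) (hα : IsCocycle α) (hnorm : IsNormalized α)
    (g : G) (l : List G) (v : G → k) :
    rinvs α l (Lmul α g v) = Lmul α g (rinvs α l v) := by
  induction l with
  | nil => rfl
  | cons h l ih =>
    funext y
    have hc := hα g (g⁻¹ * y) h
    rw [mul_inv_cancel_left] at hc
    have hu : (α y h)⁻¹ * α g (g⁻¹ * y * h) = α g (g⁻¹ * y) * (α (g⁻¹ * y) h)⁻¹ := by
      rw [eq_mul_inv_iff_mul_eq, mul_assoc, hc, inv_mul_cancel_left]
    rw [rinvs_cons α hα hnorm, ih]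
    change _ * ((α g (g⁻¹ * (y * h)) : k) * rinvs α l v (g⁻¹ * (y * h))) =
      (α g (g⁻¹ * y) : k) * rinvs α (h :: l) v (g⁻¹ * y)
    rw [rinvs_cons α hα hnorm, ← mul_assoc, ← mul_assoc, ← mul_assoc,
      ← Units.val_mul, ← Units.val_mul, hu]

theorem rinvs_cons_Lmul_of_commute (α : G → G → kˣ) (hα : IsCocycle α)
    (hnorm : IsNormalized α) {x h : G} (hx : Commute h x) (l : List G) (v : G → k) :
    rinvs α (h :: l) (Lmul α h v) x = chi α x h * rinvs α l v x := by
  rw [rinvs_cons α hα hnorm, rinvs_Lmul α hα hnorm]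
  change _ * ((α h (h⁻¹ * (x * h)) : k) * rinvs α l v (h⁻¹ * (x * h))) = _
  rw [← hx.eq, inv_mul_cancel_left, chi]
  ring

theorem smul_rinvs_cons_cons (α : G → G → kˣ) (hα : IsCocycle α) (hnorm : IsNormalized α)
    (g h : G) (l : List G) (v : G → k) :
    (α g h : k) • rinvs α (g :: h :: l) v = rinvs α (g * h :: l) v := by
  funext y
  have hu : α g h * ((α y g)⁻¹ * (α (y * g) h)⁻¹) = (α y (g * h))⁻¹ := by
    rw [← mul_inv, mul_comm (α y g), ← hα, mul_inv, mul_comm (α y (g * h))⁻¹,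
      mul_inv_cancel_left]
  rw [Pi.smul_apply, smul_eq_mul]
  simp only [rinvs_cons α hα hnorm]
  rw [← hu, Units.val_mul, Units.val_mul, mul_assoc y]
  simp only [mul_assoc]

theorem mergeAt_zero {n : ℕ} (g : Fin (n + 2) → G) :
    mergeAt g 0 = Fin.cons (g 0 * g 1) (fun j => g j.succ.succ) := by
  funext l
  refine Fin.cases ?_ (fun l => ?_) l <;> simp [mergeAt, Fin.succ_ne_zero]

theorem mergeAt_succ {n : ℕ} (g : Fin (n + 2) → G) (j : Fin n) :
    mergeAt g j.succ = Fin.cons (g 0) (mergeAt (fun i => g i.succ) j) := by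
  funext l
  refine Fin.cases ?_ (fun l => ?_) l <;> simp [mergeAt]

theorem smul_rinvs_ofFn (α : G → G → kˣ) (hα : IsCocycle α) (hnorm : IsNormalized α)
    {n : ℕ} (g : Fin (n + 1) → G) (j : Fin n) (v : G → k) :
    (α (g j.castSucc) (g j.succ) : k) • rinvs α (List.ofFn g) v =
      rinvs α (List.ofFn (mergeAt g j)) v := by
  induction n with
  | zero => exact j.elim0
  | succ n ih =>
    refine Fin.cases ?_ (fun j => ?_) j
    · rw [mergeAt_zero]
      simpa [List.ofFn_succ] using
        smul_rinvs_cons_cons α hα hnorm (g 0) (g 1) (List.ofFn fun j : Fin n => g j.succ.succ) v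
    · rw [mergeAt_succ, List.ofFn_cons, List.ofFn_succ (f := g)]
      funext y
      have hy := congrFun (ih (fun i => g i.succ) j) (y * g 0)
      simp only [Pi.smul_apply, smul_eq_mul] at hy ⊢
      rw [rinvs_cons α hα hnorm, rinvs_cons α hα hnorm, ← hy, mul_left_comm]
      rfl

theorem map_mergeAt {H K : Type*} [Group H] [Group K] (f : H →* K) {n : ℕ}
    (h : Fin (n + 1) → H) (j : Fin n) :
    mergeAt (fun i => f (h i)) j = fun i => f (mergeAt h j i) := by
  funext l
  simp only [mergeAt]
  split_ifs <;> simp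

end RightInverse

/-- for any `x ∈ G` the maps `π^*_{G,x,α}` commute with the Hochschild
differential `δ^*` and the group-cohomology differential `∂^*` of
`C^*(C_G(x), k x̄)`. -/
theorem piC_comm_diff
    {k : Type*} [Field k] {G : Type*} [Group G] [Fintype G] [DecidableEq G]
    (α : G → G → kˣ) (hα : IsCocycle α) (hnorm : IsNormalized α) (x : G)
    {n : ℕ} (φ : (Fin n → G) → (G → k)) :
    piC α x (hDiff α (Lmul α) (Rmul α) φ) =
      cDiff (fun h : Subgroup.centralizer ({x} : Set G) => chi α x (h : G))
        (piC α x φ) := by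
  funext h
  set g : Fin (n + 1) → G := fun i => (h i : G)
  have hmerge (j : Fin n) : (fun i => ((mergeAt h j i : Subgroup.centralizer ({x} : Set G)) : G)) = mergeAt g j :=
    (map_mergeAt (Subgroup.subtype _) h j).symm
  have hcomm : Commute (g 0) x :=
    (Subgroup.mem_centralizer_singleton_iff.mp (h 0).2)
  change rinvsLinear α (List.ofFn g) (hDiff α (Lmul α) (Rmul α) φ g) x = _
  simp only [hDiff, cDiff, piC, map_add, map_sum, map_zsmul, map_smul, Pi.add_apply,
    Finset.sum_apply, Pi.smul_apply, hmerge]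
  congr 1
  · congr 1
    · rw [List.ofFn_succ]
      exact rinvs_cons_Lmul_of_commute α hα hnorm hcomm _ _
    · refine Finset.sum_congr rfl fun j _ => congrArg _ ?_
      rw [← smul_rinvs_ofFn α hα hnorm g j]
      rfl
  · congr 1
    change rinvs α (List.ofFn g) _ x = _
    rw [List.ofFn_succ', List.concat_eq_append, rinvs_append,
      rinvs_singleton_Rmul α hα hnorm]

end TwistedSym
end

section
/- Let n ≥ 0 and x, y ∈ Z(G). Then π^n_{G,x,α} ∘ ν^n_{G,y,α} is the identity of C^n(G, k x̄) if x = y, and is the zero map if x ≠ y. Consequently (⊕_{x∈Z(G)} π^n_{G,x,α}) ∘ (⊕_{x∈Z(G)} ν^n_{G,x,α}) is the identity of ⊕_{x∈Z(G)} C^n(G, k x̄). -/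
/- Common setup: twisted group algebras modelled on their canonical basis.
An element of the twisted group algebra `k_αG` is modelled as a function `G → k`
(its coordinates in the basis `{ḡ : g ∈ G}`), and a Hochschild `n`-cochain
`Hom_k((k_αG)^{⊗n}, M)` is modelled by its values on basis tensors, i.e. as a
function `(Fin n → G) → M`.  Similarly a group cochain `C^n(H, A)` is a function
`(Fin n → H) → A`; the one-dimensional module `k x̄` is modelled as `k` with the
action of `h` given by multiplication by the character `χ(h) = α(h,x)·α(x,h)⁻¹`. -/

namespace TwistedSym

section InverseMultiplication

variable {k : Type*} [CommRing k] {G : Type*} [Group G]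

/-- Right multiplication by `ḡ` followed by right multiplication by `ḡ⁻¹` is the identity. -/
lemma inv_smul_Rmul_inv_Rmul {α : G → G → kˣ} (hα : IsCocycle α) (hnorm : IsNormalized α)
    (g : G) (v : G → k) :
    (((α g g⁻¹)⁻¹ : kˣ) : k) • Rmul α g⁻¹ (Rmul α g v) = v := by
  funext y
  have h := congrArg (Units.val : kˣ → k) (hα y g g⁻¹)
  simp only [mul_inv_cancel, (hnorm y).2, one_mul, Units.val_mul] at h
  simp only [Rmul, LinearMap.coe_mk, AddHom.coe_mk, Pi.smul_apply, smul_eq_mul, inv_inv,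
    mul_inv_cancel_right]
  rw [← mul_assoc (α (y * g) g⁻¹ : k), ← h, Units.inv_mul_cancel_left]

lemma rinvs_rmuls {α : G → G → kˣ} (hα : IsCocycle α) (hnorm : IsNormalized α)
    (l : List G) (v : G → k) : rinvs α l (rmuls α l v) = v := by
  induction l generalizing v with
  | nil => rfl
  | cons g l ih =>
    have h : rinvs α (g :: l) (rmuls α (g :: l) v) =
        (((α g g⁻¹)⁻¹ : kˣ) : k) • Rmul α g⁻¹ (rinvs α l (rmuls α l (Rmul α g v))) := rfl
    rw [h, ih, inv_smul_Rmul_inv_Rmul hα hnorm]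

lemma isLinearMap_rmuls (α : G → G → kˣ) (l : List G) : IsLinearMap k (rmuls α l) := by
  induction l with
  | nil => exact LinearMap.id.isLinear
  | cons g l ih => exact ((ih.mk' _).comp (Rmul α g)).isLinear

variable [DecidableEq G]

lemma piZ_sum_nuZ {α : G → G → kˣ} (hα : IsCocycle α) (hnorm : IsNormalized α) {n : ℕ}
    (x : G) (s : Finset G) (ψ : G → (Fin n → G) → k) :
    piZ α x (∑ y ∈ s, nuZ α y (ψ y)) = if x ∈ s then ψ x else 0 := by
  funext g
  have h : (∑ y ∈ s, nuZ α y (ψ y)) g =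
      rmuls α (List.ofFn g) (∑ y ∈ s, ψ y g • (Pi.single y 1 : G → k)) := by
    have hlin := isLinearMap_rmuls α (List.ofFn g)
    rw [← hlin.mk'_apply, map_sum]
    simp only [hlin.map_smul, hlin.mk'_apply, Finset.sum_apply, nuZ]
  rw [piZ, h, rinvs_rmuls hα hnorm]
  split_ifs with hx <;> simp [Finset.sum_apply, Pi.single_apply, hx]

lemma piZ_nuZ {α : G → G → kˣ} (hα : IsCocycle α) (hnorm : IsNormalized α) {n : ℕ}
    (x y : G) (ψ : (Fin n → G) → k) :
    piZ α x (nuZ α y ψ) = if x = y then ψ else 0 := by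
  simpa using piZ_sum_nuZ hα hnorm x {y} fun _ => ψ

end InverseMultiplication

/-- for `x, y ∈ Z(G)`, `π^n_{G,x,α} ∘ ν^n_{G,y,α}` is the identity of
`C^n(G, k x̄)` if `x = y` and zero if `x ≠ y`; consequently
`(⊕_{x∈Z(G)} π^n_{G,x,α}) ∘ (⊕_{x∈Z(G)} ν^n_{G,x,α})` is the identity of
`⊕_{x∈Z(G)} C^n(G, k x̄)`. -/
theorem pi_nu_orthogonality
    {k : Type*} [Field k] {G : Type*} [Group G] [Fintype G] [DecidableEq G]
    [DecidablePred fun g : G => g ∈ Subgroup.center G]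
    (α : G → G → kˣ) (hα : IsCocycle α) (hnorm : IsNormalized α) {n : ℕ} :
    (∀ x ∈ Subgroup.center G, ∀ ψ : (Fin n → G) → k, piZ α x (nuZ α x ψ) = ψ) ∧
    (∀ x ∈ Subgroup.center G, ∀ y ∈ Subgroup.center G, x ≠ y →
      ∀ ψ : (Fin n → G) → k, piZ α x (nuZ α y ψ) = 0) ∧
    (∀ ψf : G → (Fin n → G) → k, ∀ x ∈ Subgroup.center G,
      piZ α x (∑ y ∈ Finset.univ.filter (fun g : G => g ∈ Subgroup.center G),
        nuZ α y (ψf y)) = ψf x) := by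
  refine ⟨fun x _ ψ => ?_, fun x _ y _ hxy ψ => ?_, fun ψf x hx => ?_⟩
  · rw [piZ_nuZ hα hnorm, if_pos rfl]
  · rw [piZ_nuZ hα hnorm, if_neg hxy]
  · rw [piZ_sum_nuZ hα hnorm, if_pos (by simpa using hx)]

end TwistedSym
end

section
/- Let n ≥ 1 and x ∈ G. Then δ^{n−1} ∘ ν^{n−1}_{G,x} = ν^n_{G,x} ∘ ∂^{n−1} as maps C^{n−1}(C_G(x), kx) → C^n(kG,kG); that is, for the ordinary group algebra the maps ν^*_{G,x} commute with the group-cohomology differential ∂^* of C^*(C_G(x),kx) and the Hochschild differential δ^* of C^*(kG,kG). -/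
/- Common setup: twisted group algebras modelled on their canonical basis.
An element of the twisted group algebra `k_αG` is modelled as a function `G → k`
(its coordinates in the basis `{ḡ : g ∈ G}`), and a Hochschild `n`-cochain
`Hom_k((k_αG)^{⊗n}, M)` is modelled by its values on basis tensors, i.e. as a
function `(Fin n → G) → M`.  Similarly a group cochain `C^n(H, A)` is a function
`(Fin n → H) → A`; the one-dimensional module `k x̄` is modelled as `k` with the
action of `h` given by multiplication by the character `χ(h) = α(h,x)·α(x,h)⁻¹`. -/

namespace TwistedSym

section CosetDecomposition

variable {G : Type*} [Group G]

lemma mergeAt_eq_contractNth {n : ℕ} (g : Fin (n + 1) → G) (p : Fin n) :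
    mergeAt g p = Fin.contractNth p.castSucc (· * ·) g := by
  funext l
  simp [mergeAt, Fin.contractNth, Fin.ext_iff]

lemma partialProd_mergeAt_last {n : ℕ} (g : Fin (n + 1) → G) (p : Fin n) :
    Fin.partialProd (mergeAt g p) (Fin.last n) = Fin.partialProd g (Fin.last (n + 1)) := by
  rw [mergeAt_eq_contractNth, Fin.partialProd_contractNth, Function.comp_apply,
    Fin.succAbove_of_le_castSucc _ _ (by simp [Fin.le_def]), Fin.succ_last]

lemma Lmul_one_single {k : Type*} [CommRing k] [DecidableEq G] (a y : G) :
    Lmul (fun _ _ => (1 : kˣ)) a (Pi.single y 1) = Pi.single (a * y) 1 := by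
  funext z
  simp [Lmul, Pi.single_apply, inv_mul_eq_iff_eq_mul]

lemma Rmul_one_single {k : Type*} [CommRing k] [DecidableEq G] (a y : G) :
    Rmul (fun _ _ => (1 : kˣ)) a (Pi.single y 1) = Pi.single (y * a) 1 := by
  funext z
  simp [Rmul, Pi.single_apply, mul_inv_eq_iff_eq_mul]

variable {x : G} {m : ℕ} {γ : Fin m → G} {idx : Fin m → G → Fin m} {rep : Fin m → G → G}

lemma conj_coset_rep_mul (hrep : ∀ j a, rep j a ∈ Subgroup.centralizer ({x} : Set G))
    (hidx : ∀ j a, γ j * a = rep j a * γ (idx j a)) (j : Fin m) (a : G) :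
    a * ((γ (idx j a))⁻¹ * x * γ (idx j a)) = (γ j)⁻¹ * x * γ j * a := by
  have hγ : γ (idx j a) = (rep j a)⁻¹ * (γ j * a) := by rw [hidx, inv_mul_cancel_left]
  have hx : x * rep j a = rep j a * x := Subgroup.mem_centralizer_iff.1 (hrep j a) x rfl
  have hx' : rep j a * x * (rep j a)⁻¹ = x := by rw [← hx, mul_inv_cancel_right]
  calc a * ((γ (idx j a))⁻¹ * x * γ (idx j a))
      = (γ j)⁻¹ * (rep j a * x * (rep j a)⁻¹) * γ j * a := by rw [hγ]; group
    _ = (γ j)⁻¹ * x * γ j * a := by rw [hx']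

section Index

variable (hrep : ∀ j a, rep j a ∈ Subgroup.centralizer ({x} : Set G))
  (hidx : ∀ j a, γ j * a = rep j a * γ (idx j a))
  (hcover : ∀ g : G, ∃! j : Fin m, g * (γ j)⁻¹ ∈ Subgroup.centralizer ({x} : Set G))

include hcover in
lemma eq_of_mul_coset_rep_eq {c d : G} (hc : c ∈ Subgroup.centralizer ({x} : Set G))
    (hd : d ∈ Subgroup.centralizer ({x} : Set G)) {i j : Fin m} (h : c * γ i = d * γ j) :
    i = j := by
  refine (hcover (c * γ i)).unique ?_ ?_
  · rwa [mul_inv_cancel_right]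
  · rwa [h, mul_inv_cancel_right]

include hrep hidx hcover

lemma idx_one (j : Fin m) : idx j 1 = j :=
  eq_of_mul_coset_rep_eq hcover (hrep j 1) (one_mem _) (by rw [← hidx, mul_one, one_mul])

lemma idx_mul (j : Fin m) (a b : G) : idx j (a * b) = idx (idx j a) b :=
  eq_of_mul_coset_rep_eq hcover (hrep j (a * b)) (mul_mem (hrep j a) (hrep (idx j a) b)) (by
    rw [← hidx, mul_assoc, ← hidx, ← mul_assoc, ← mul_assoc, ← hidx])

lemma rep_mul (j : Fin m) (a b : G) : rep j (a * b) = rep j a * rep (idx j a) b := by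
  refine mul_right_cancel (b := γ (idx j (a * b))) ?_
  rw [← hidx, idx_mul hrep hidx hcover, mul_assoc, ← hidx, ← mul_assoc, ← mul_assoc, ← hidx]

lemma idx_bijective (a : G) : Function.Bijective fun j => idx j a := by
  have h_inv (b : G) (j : Fin m) : idx (idx j b) b⁻¹ = j := by
    rw [← idx_mul hrep hidx hcover, mul_inv_cancel, idx_one hrep hidx hcover]
  exact ⟨Function.LeftInverse.injective (g := fun j => idx j a⁻¹) (h_inv a),
    Function.RightInverse.surjective (g := fun j => idx j a⁻¹) fun j => by
      simpa using h_inv a⁻¹ j⟩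

lemma chainIdx_eq_idx_prod (j : Fin m) (l : List G) : chainIdx idx j l = idx j l.prod := by
  induction l generalizing j with
  | nil => rw [chainIdx, List.prod_nil, idx_one hrep hidx hcover]
  | cons a l ih => rw [chainIdx, ih, List.prod_cons, idx_mul hrep hidx hcover]

end Index

/-- The tuple `(h_{j,1}, …, h_{j,n})` of elements of `C_G(x)` attached to `(g₁, …, gₙ)`. -/
def cosetTuple (idx : Fin m → G → Fin m)
    (hrep : ∀ j a, rep j a ∈ Subgroup.centralizer ({x} : Set G)) {n : ℕ} (j : Fin m)
    (g : Fin n → G) : Fin n → Subgroup.centralizer ({x} : Set G) := fun i =>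
  ⟨rep (idx j (Fin.partialProd g i.castSucc)) (g i), hrep _ _⟩

variable (hrep : ∀ j a, rep j a ∈ Subgroup.centralizer ({x} : Set G))
  (hidx : ∀ j a, γ j * a = rep j a * γ (idx j a))
  (hcover : ∀ g : G, ∃! j : Fin m, g * (γ j)⁻¹ ∈ Subgroup.centralizer ({x} : Set G))

lemma cosetTuple_init {n : ℕ} (j : Fin m) (g : Fin (n + 1) → G) :
    cosetTuple idx hrep j (fun i => g i.castSucc) =
      fun i => cosetTuple idx hrep j g i.castSucc := by
  funext i
  have h : Fin.partialProd (fun i => g (Fin.castSucc i)) i.castSucc =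
      Fin.partialProd g i.castSucc.castSucc := Fin.partialProd_init (f := g) i.castSucc
  simp only [cosetTuple, h]

include hidx hcover

lemma cosetTuple_tail {n : ℕ} (j : Fin m) (g : Fin (n + 1) → G) :
    cosetTuple idx hrep (idx j (g 0)) (fun i => g i.succ) =
      fun i => cosetTuple idx hrep j g i.succ := by
  funext i
  have h : Fin.partialProd g i.succ.castSucc =
      g 0 * Fin.partialProd (fun i => g (Fin.succ i)) i.castSucc :=
    Fin.partialProd_succ' g i.castSucc
  simp only [cosetTuple, h, idx_mul hrep hidx hcover]

lemma cosetTuple_mergeAt {n : ℕ} (j : Fin m) (g : Fin (n + 1) → G) (p : Fin n) :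
    cosetTuple idx hrep j (mergeAt g p) = mergeAt (cosetTuple idx hrep j g) p := by
  funext l
  have h_prod : Fin.partialProd (mergeAt g p) l.castSucc =
      Fin.partialProd g (p.castSucc.succ.succAbove l.castSucc) := by
    rw [mergeAt_eq_contractNth, Fin.partialProd_contractNth, Function.comp_apply]
  apply Subtype.ext
  rcases lt_trichotomy (l : ℕ) p with h | h | h
  · rw [Fin.succAbove_of_castSucc_lt _ _ (by simp [Fin.lt_def]; lia)] at h_prod
    simp [cosetTuple, h_prod, mergeAt, h]
  · obtain rfl : l = p := Fin.ext h
    rw [Fin.succAbove_of_castSucc_lt _ _ (by simp [Fin.lt_def])] at h_prod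
    have h_succ : Fin.partialProd g l.succ.castSucc =
        Fin.partialProd g l.castSucc.castSucc * g l.castSucc := Fin.partialProd_succ g l.castSucc
    simp only [cosetTuple, h_prod, mergeAt, lt_irrefl, if_true, if_false, h_succ,
      idx_mul hrep hidx hcover, rep_mul hrep hidx hcover, Subgroup.coe_mul]
  · rw [Fin.succAbove_of_le_castSucc _ _ (by simp [Fin.le_def]; lia)] at h_prod
    simp [cosetTuple, h_prod, mergeAt, h.not_gt, Fin.ext_iff, h.ne']

variable {k : Type*} [CommRing k] [DecidableEq G]

lemma nuT_apply {n : ℕ} (ψ : (Fin n → Subgroup.centralizer ({x} : Set G)) → k) (g : Fin n → G) :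
    nuT x γ idx rep hrep ψ g = ∑ j : Fin m, ψ (cosetTuple idx hrep j g) •
      (Pi.single ((γ j)⁻¹ * x * γ j * Fin.partialProd g (Fin.last n)) (1 : k) : G → k) := by
  have h_tuple (j : Fin m) : cosetTuple idx hrep j g = fun i : Fin n =>
      ⟨rep (idx j ((List.ofFn g).take (i : ℕ)).prod) (g i), hrep _ _⟩ := rfl
  simp [nuT, h_tuple, Fin.partialProd, chainIdx_eq_idx_prod hrep hidx hcover,
    List.take_of_length_le]

lemma Lmul_nuT_tail {n : ℕ} (ψ : (Fin n → Subgroup.centralizer ({x} : Set G)) → k)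
    (g : Fin (n + 1) → G) :
    Lmul (fun _ _ => (1 : kˣ)) (g 0) (nuT x γ idx rep hrep ψ fun i => g i.succ) =
      ∑ j : Fin m, ψ (fun i => cosetTuple idx hrep j g i.succ) •
        (Pi.single ((γ j)⁻¹ * x * γ j * Fin.partialProd g (Fin.last (n + 1))) (1 : k) :
          G → k) := by
  have h : Fin.partialProd g (Fin.last (n + 1)) =
      g 0 * Fin.partialProd (fun i => g (Fin.succ i)) (Fin.last n) :=
    Fin.partialProd_succ' g (Fin.last n)
  rw [nuT_apply hrep hidx hcover, map_sum,
    ← (idx_bijective hrep hidx hcover (g 0)).sum_comp]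
  refine Finset.sum_congr rfl fun j _ => ?_
  rw [map_smul, Lmul_one_single, cosetTuple_tail hrep hidx hcover, h, ← mul_assoc,
    conj_coset_rep_mul hrep hidx, mul_assoc _ (g 0)]

lemma nuT_mergeAt {n : ℕ} (ψ : (Fin n → Subgroup.centralizer ({x} : Set G)) → k)
    (g : Fin (n + 1) → G) (p : Fin n) :
    nuT x γ idx rep hrep ψ (mergeAt g p) =
      ∑ j : Fin m, ψ (mergeAt (cosetTuple idx hrep j g) p) •
        (Pi.single ((γ j)⁻¹ * x * γ j * Fin.partialProd g (Fin.last (n + 1))) (1 : k) :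
          G → k) := by
  simp only [nuT_apply hrep hidx hcover, cosetTuple_mergeAt hrep hidx hcover,
    partialProd_mergeAt_last]

lemma Rmul_nuT_init {n : ℕ} (ψ : (Fin n → Subgroup.centralizer ({x} : Set G)) → k)
    (g : Fin (n + 1) → G) :
    Rmul (fun _ _ => (1 : kˣ)) (g (Fin.last n)) (nuT x γ idx rep hrep ψ fun i => g i.castSucc) =
      ∑ j : Fin m, ψ (fun i => cosetTuple idx hrep j g i.castSucc) •
        (Pi.single ((γ j)⁻¹ * x * γ j * Fin.partialProd g (Fin.last (n + 1))) (1 : k) :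
          G → k) := by
  have h : Fin.partialProd g (Fin.last (n + 1)) =
      Fin.partialProd (fun i => g (Fin.castSucc i)) (Fin.last n) * g (Fin.last n) := by
    rw [← Fin.succ_last, Fin.partialProd_succ]
    exact congrArg (· * g (Fin.last n)) (Fin.partialProd_init (f := g) (Fin.last n)).symm
  rw [nuT_apply hrep hidx hcover, map_sum]
  refine Finset.sum_congr rfl fun j _ => ?_
  rw [map_smul, Rmul_one_single, cosetTuple_init, h, mul_assoc _ _ (g (Fin.last n))]

end CosetDecomposition

/-- for the ordinary group algebra `kG`, the maps `ν^*_{G,x}` (defined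
via a right coset decomposition of `C_G(x)` in `G`) commute with the
group-cohomology differential of `C^*(C_G(x), kx)` and the Hochschild differential
of `C^*(kG, kG)`. -/
theorem nuT_comm_diff
    {k : Type*} [CommRing k] {G : Type*} [Group G] [Fintype G] [DecidableEq G]
    (x : G) {m : ℕ} (γ : Fin m → G) (idx : Fin m → G → Fin m) (rep : Fin m → G → G)
    (hrep : ∀ j a, rep j a ∈ Subgroup.centralizer ({x} : Set G))
    (hm : 0 < m) (hγ1 : γ ⟨0, hm⟩ = 1)
    (hidx : ∀ j a, γ j * a = rep j a * γ (idx j a))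
    (hcover : ∀ g : G, ∃! j : Fin m, g * (γ j)⁻¹ ∈ Subgroup.centralizer ({x} : Set G))
    {n : ℕ} (ψ : (Fin n → Subgroup.centralizer ({x} : Set G)) → k) :
    nuT x γ idx rep hrep (cDiff (fun _ => (1 : k)) ψ) =
      hDiff (fun _ _ => (1 : kˣ)) (Lmul fun _ _ => (1 : kˣ)) (Rmul fun _ _ => (1 : kˣ))
        (nuT x γ idx rep hrep ψ) := by
  funext g
  rw [nuT_apply hrep hidx hcover, hDiff, Lmul_nuT_tail hrep hidx hcover,
    Rmul_nuT_init hrep hidx hcover]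
  simp only [nuT_mergeAt hrep hidx hcover, cDiff, one_mul, Units.val_one, one_smul, add_smul,
    Finset.sum_add_distrib, Finset.sum_smul, Finset.smul_sum, smul_assoc]
  rw [Finset.sum_comm]

end TwistedSym
end
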